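/- Comparison principle under a Lipschitz growth condition (Proposition 3.7). Assume the Hamiltonian H = (H^j) satisfies (H0), (H1) and the growth condition: there exists K > 0 such that |H^j(x,r,p) − H^j(x,s,q)| ≤ K(|r−s| + |p−q|) for all j ∈ J, x ∈ [0,l_j] and all r,s,p,q ∈ ℝ. Let β = (β_{ij}) be weights with β_{ij} > 0 for every i ∈ I_T and j ∈ Inc_i, let ε > 0, and let w₁, w₂ ∈ C²(Γ) satisfy (CP). Then w₁ ≥ w₂ everywhere on Γ. -/

import Mathlib

open Set

noncomputable section

/-- A finite connected topological network. -/
structure Network where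
  I : Type
  J : Type
  finI : Fintype I
  finJ : Fintype J
  neI : Nonempty I
  neJ : Nonempty J
  l : J → ℝ
  l_pos : ∀ j, 0 < l j
  s : J → I
  t : J → I
  st_ne : ∀ j, s j ≠ t j
  conn : ∀ i i' : I,
    Relation.ReflTransGen (fun a b => ∃ j, (s j = a ∧ t j = b) ∨ (s j = b ∧ t j = a)) i i'
  IB : Set I
  IB_ne : IB.Nonempty
  deg_one_bd : ∀ i : I, ({j : J | s j = i ∨ t j = i} : Set J).ncard = 1 → i ∈ IB

attribute [instance] Network.finI Network.finJ Network.neI Network.neJ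

namespace Network

open scoped Classical

variable (N : Network)

/-- The set of edges incident to the vertex `i`. -/
def Inc (i : N.I) : Set N.J := {j | N.s j = i ∨ N.t j = i}

/-- The set of transition vertices. -/
def IT : Set N.I := N.IBᶜ

/-- The signed incidence `a_{ij}`. -/
def sgn (i : N.I) (j : N.J) : ℝ := if N.s j = i then 1 else -1

/-- The parameter `y_i^j` of the vertex `i` on the edge `j`. -/
def param (i : N.I) (j : N.J) : ℝ := if N.s j = i then 0 else N.l j

/-- The edge `j` as a parameter interval. -/
def edge (j : N.J) : Set ℝ := Icc 0 (N.l j)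

/-- A family `(u^j)` of functions on the edges defines a function on the network iff
the values at each vertex agree. -/
def Compat (u : N.J → ℝ → ℝ) : Prop :=
  ∀ i : N.I, ∀ j ∈ N.Inc i, ∀ k ∈ N.Inc i, u j (N.param i j) = u k (N.param i k)

/-- `u ∈ C(Γ)`. -/
def IsCont (u : N.J → ℝ → ℝ) : Prop :=
  N.Compat u ∧ ∀ j, ContinuousOn (u j) (N.edge j)

/-- `u ∈ C²(Γ)`. -/
def IsC2 (u : N.J → ℝ → ℝ) : Prop :=
  N.Compat u ∧ ∀ j, ContDiffOn ℝ 2 (u j) (N.edge j)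

/-- First derivative `∂_j u` along the edge `j`. -/
def pd (u : N.J → ℝ → ℝ) (j : N.J) (x : ℝ) : ℝ := derivWithin (u j) (N.edge j) x

/-- Second derivative `∂²_j u` along the edge `j`. -/
def pd2 (u : N.J → ℝ → ℝ) (j : N.J) (x : ℝ) : ℝ := derivWithin (N.pd u j) (N.edge j) x

/-- Sum over the edges incident to `i`. -/
def incSum (i : N.I) (f : N.J → ℝ) : ℝ := ∑ j : N.J, if j ∈ N.Inc i then f j else 0

/-- The Kirchhoff sum `S^i_β u`. -/
def kir (β : N.I → N.J → ℝ) (u : N.J → ℝ → ℝ) (i : N.I) : ℝ :=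
  N.incSum i (fun j => β i j * N.sgn i j * N.pd u j (N.param i j))

/-- `u ∈ C²_{*,β}(Γ)`. -/
def IsC2Star (β : N.I → N.J → ℝ) (u : N.J → ℝ → ℝ) : Prop :=
  N.IsC2 u ∧ ∀ i ∈ N.IT, N.kir β u i = 0

/-- (H0): continuity of each `H^j`. -/
def H0 (H : N.J → ℝ → ℝ → ℝ → ℝ) : Prop :=
  ∀ j, ContinuousOn (fun q : ℝ × ℝ × ℝ => H j q.1 q.2.1 q.2.2)
    ((N.edge j) ×ˢ (univ : Set ℝ) ×ˢ (univ : Set ℝ))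

/-- (H1): `r ↦ H^j(x,r,p)` is nondecreasing. -/
def H1 (H : N.J → ℝ → ℝ → ℝ → ℝ) : Prop :=
  ∀ j, ∀ x ∈ N.edge j, ∀ p : ℝ, Monotone fun r => H j x r p

/-- (H3): `p ↦ H^j(v_i,r,p)` is nondecreasing on `(0,∞)` at transition vertices. -/
def H3 (H : N.J → ℝ → ℝ → ℝ → ℝ) : Prop :=
  ∀ i ∈ N.IT, ∀ j ∈ N.Inc i, ∀ r : ℝ,
    MonotoneOn (fun p => H j (N.param i j) r p) (Ioi (0 : ℝ))

/-- (H4): coercivity in `p`, uniform on bounded `r`-sets. -/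
def H4 (H : N.J → ℝ → ℝ → ℝ → ℝ) : Prop :=
  ∀ j, ∀ R : ℝ, 0 < R → ∀ A : ℝ, ∃ M : ℝ, ∀ x ∈ N.edge j, ∀ r : ℝ, |r| ≤ R →
    ∀ p : ℝ, M < |p| → A < H j x r p

/-- (H5): continuity of `H` at the transition vertices. -/
def H5 (H : N.J → ℝ → ℝ → ℝ → ℝ) : Prop :=
  ∀ i ∈ N.IT, ∀ j ∈ N.Inc i, ∀ k ∈ N.Inc i, ∀ r p : ℝ,
    H j (N.param i j) r p = H k (N.param i k) r p

/-- (H6): symmetry of `H` in `p` at the transition vertices. -/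
def H6 (H : N.J → ℝ → ℝ → ℝ → ℝ) : Prop :=
  ∀ i ∈ N.IT, ∀ j ∈ N.Inc i, ∀ r p : ℝ,
    H j (N.param i j) r p = H j (N.param i j) r (-p)

end Network

/-- The hypotheses (CP) of the comparison principles: `w₁` is a supersolution and `w₂` a
subsolution of the viscous equation, the Kirchhoff sums are ordered, and the boundary
values are ordered. -/
def Network.CP (N : Network) (H : N.J → ℝ → ℝ → ℝ → ℝ) (β : N.I → N.J → ℝ) (ε : ℝ)
    (w₁ w₂ : N.J → ℝ → ℝ) : Prop :=
  (∀ j, ∀ x ∈ N.edge j,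
    -ε * N.pd2 w₂ j x + H j x (w₂ j x) (N.pd w₂ j x) ≤
      -ε * N.pd2 w₁ j x + H j x (w₁ j x) (N.pd w₁ j x)) ∧
  (∀ i ∈ N.IT, N.kir β w₁ i ≤ N.kir β w₂ i) ∧
  (∀ i ∈ N.IB, ∀ j ∈ N.Inc i, w₂ j (N.param i j) ≤ w₁ j (N.param i j))

lemma IsMaxOn.hasDerivWithinAt_mul_sub_nonpos {s : Set ℝ} {f : ℝ → ℝ} {f' x y : ℝ}
    (hs : Convex ℝ s) (hmax : IsMaxOn f s x) (hf : HasDerivWithinAt f f' s x)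
    (hx : x ∈ s) (hy : y ∈ s) : f' * (y - x) ≤ 0 := by
  have h := hmax.localize.hasFDerivWithinAt_nonpos hf.hasFDerivWithinAt
    (sub_mem_posTangentConeAt_of_segment_subset (hs.segment_subset hx hy))
  simpa [mul_comm] using h

lemma nonneg_of_neg_mul_abs_le_deriv {a b C : ℝ} {v v' : ℝ → ℝ}
    (hv : ∀ x ∈ Icc a b, HasDerivWithinAt v (v' x) (Icc a b) x)
    (hC : ∀ x ∈ Ico a b, -C * |v x| ≤ v' x) (ha : 0 ≤ v a) :
    ∀ x ∈ Icc a b, 0 ≤ v x := by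
  intro x hx
  have key : ∀ δ > 0, -v x ≤ δ * Real.exp ((C + 1) * (x - a)) := by
    intro δ hδ
    refine image_le_of_deriv_right_lt_deriv_boundary (f := fun y => -v y)
      (f' := fun y => -v' y) (B := fun y => δ * Real.exp ((C + 1) * (y - a)))
      (B' := fun y => δ * (Real.exp ((C + 1) * (y - a)) * ((C + 1) * 1)))
      (fun y hy => (hv y hy).continuousWithinAt.neg) ?_ ?_ ?_ ?_ hx
    · intro y hy
      exact ((hv y (Ico_subset_Icc_self hy)).mono_of_mem_nhdsWithin
        (Icc_mem_nhdsGE_of_mem hy)).neg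
    · simp only [sub_self, mul_zero, Real.exp_zero, mul_one]
      linarith
    · intro y
      exact ((((hasDerivAt_id y).sub_const a).const_mul (C + 1)).exp).const_mul δ
    · intro y hy hyB
      have hpos : 0 < δ * Real.exp ((C + 1) * (y - a)) := by positivity
      have h := hC y hy
      rw [← abs_neg, hyB, abs_of_pos hpos] at h
      linarith
  by_contra! hneg
  have h := key (-v x / 2 / Real.exp ((C + 1) * (x - a)))
    (div_pos (by linarith) (Real.exp_pos _))
  rw [div_mul_cancel₀ _ (Real.exp_pos _).ne'] at h
  linarith

open Topology in
/-- One-dimensional strong maximum principle, to the right of a critical maximum point. -/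
lemma eq_max_right_of_deriv2_ge {a b C M : ℝ} {u v w : ℝ → ℝ}
    (hu : ∀ x ∈ Icc a b, HasDerivWithinAt u (v x) (Icc a b) x)
    (hv : ∀ x ∈ Icc a b, HasDerivWithinAt v (w x) (Icc a b) x)
    (hC : ∀ x ∈ Icc a b, 0 < u x → -C * |v x| ≤ w x)
    (hM : 0 < M) (hle : ∀ x ∈ Icc a b, u x ≤ M) (hua : u a = M) (hva : v a = 0) :
    ∀ x ∈ Icc a b, u x = M := by
  have hcu : ContinuousOn u (Icc a b) := fun x hx => (hu x hx).continuousWithinAt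
  have hcl : IsClosed ({x | u x = M} ∩ Icc a b) := by
    rw [inter_comm]
    exact hcu.preimage_isClosed_of_isClosed isClosed_Icc isClosed_singleton
  refine hcl.Icc_subset_of_forall_mem_nhdsWithin hua ?_
  rintro y ⟨hyM, hy⟩
  have hyM : u y = M := hyM
  have hyI := Ico_subset_Icc_self hy
  have hvy : v y = 0 := by
    have hmax : IsMaxOn u (Icc a b) y := fun z hz => (hle z hz).trans hyM.ge
    rcases hy.1.eq_or_lt with rfl | hay
    · exact hva
    · have h₁ := hmax.hasDerivWithinAt_mul_sub_nonpos (convex_Icc a b) (hu y hyI) hyI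
        (left_mem_Icc.2 (hyI.1.trans hyI.2))
      have h₂ := hmax.hasDerivWithinAt_mul_sub_nonpos (convex_Icc a b) (hu y hyI) hyI
        (right_mem_Icc.2 (hyI.1.trans hyI.2))
      have hyb := hy.2
      apply le_antisymm <;> nlinarith
  have hpos : ∀ᶠ z in 𝓝[≥] y, 0 < u z :=
    ((hu y hyI).continuousWithinAt.mono_of_mem_nhdsWithin
      (Icc_mem_nhdsGE_of_mem hy)).eventually (lt_mem_nhds (hyM ▸ hM))
  obtain ⟨c, hyc, hcsub⟩ := (mem_nhdsGE_iff_exists_Icc_subset).1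
    (Filter.inter_mem hpos (Icc_mem_nhdsGE_of_mem hy))
  have hsub : Icc y c ⊆ Icc a b := fun z hz => (hcsub hz).2
  have hvnn := nonneg_of_neg_mul_abs_le_deriv
    (fun z hz => (hv z (hsub hz)).mono hsub)
    (fun z hz => hC z (hsub (Ico_subset_Icc_self hz)) (hcsub (Ico_subset_Icc_self hz)).1) hvy.ge
  have hmono : MonotoneOn u (Icc y c) := by
    refine monotoneOn_of_hasDerivWithinAt_nonneg (f' := v) (convex_Icc y c) (hcu.mono hsub) ?_ ?_
    · intro z hz
      exact (hu z (hsub (interior_subset hz))).mono (interior_subset.trans hsub)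
    · exact fun z hz => hvnn z (interior_subset hz)
  refine Filter.mem_of_superset (Icc_mem_nhdsGT hyc) fun z hz => ?_
  exact le_antisymm (hle z (hsub hz))
    (hyM ▸ hmono (left_mem_Icc.2 hyc.le) hz hz.1)

/-- One-dimensional strong maximum principle around a critical maximum point. -/
lemma eq_max_of_deriv2_ge {a b C M x₀ : ℝ} {u v w : ℝ → ℝ}
    (hu : ∀ x ∈ Icc a b, HasDerivWithinAt u (v x) (Icc a b) x)
    (hv : ∀ x ∈ Icc a b, HasDerivWithinAt v (w x) (Icc a b) x)
    (hC : ∀ x ∈ Icc a b, 0 < u x → -C * |v x| ≤ w x)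
    (hM : 0 < M) (hle : ∀ x ∈ Icc a b, u x ≤ M) (hx₀ : x₀ ∈ Icc a b)
    (hux : u x₀ = M) (hvx : v x₀ = 0) :
    ∀ x ∈ Icc a b, u x = M := by
  intro x hx
  rcases le_total x₀ x with h | h
  · have hsub : Icc x₀ b ⊆ Icc a b := Icc_subset_Icc_left hx₀.1
    exact eq_max_right_of_deriv2_ge (fun z hz => (hu z (hsub hz)).mono hsub)
      (fun z hz => (hv z (hsub hz)).mono hsub) (fun z hz => hC z (hsub hz)) hM
      (fun z hz => hle z (hsub hz)) hux hvx x ⟨h, hx.2⟩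
  · have hmaps : MapsTo (fun z : ℝ => -z) (Icc (-x₀) (-a)) (Icc a b) := by
      intro z hz
      exact ⟨by linarith [hz.2], by linarith [hz.1, hx₀.2]⟩
    have hneg : ∀ z : ℝ, HasDerivWithinAt (fun z : ℝ => -z) (-1) (Icc (-x₀) (-a)) z :=
      fun z => (hasDerivAt_neg z).hasDerivWithinAt
    have key := eq_max_right_of_deriv2_ge (a := -x₀) (b := -a) (C := C) (M := M)
      (u := fun z => u (-z)) (v := fun z => -v (-z)) (w := fun z => w (-z))
      (fun z hz => by
        simpa [Function.comp_def] using (hu (-z) (hmaps hz)).comp z (hneg z) hmaps)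
      (fun z hz => by
        simpa [Function.comp_def, Pi.neg_def] using
          ((hv (-z) (hmaps hz)).comp z (hneg z) hmaps).neg)
      (fun z hz => by simpa using hC (-z) (hmaps hz)) hM
      (fun z hz => hle (-z) (hmaps hz)) (by simpa using hux) (by simpa using hvx)
    simpa using key (-x) ⟨by linarith, by linarith [hx.1]⟩

namespace Network

variable {N : Network} {u : N.J → ℝ → ℝ} {j : N.J} {x : ℝ}

lemma IsC2.hasDerivWithinAt (hu : N.IsC2 u) (hx : x ∈ N.edge j) :
    HasDerivWithinAt (u j) (N.pd u j x) (N.edge j) x :=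
  ((hu.2 j).differentiableOn (by norm_num) x hx).hasDerivWithinAt

lemma IsC2.hasDerivWithinAt_pd (hu : N.IsC2 u) (hx : x ∈ N.edge j) :
    HasDerivWithinAt (N.pd u j) (N.pd2 u j x) (N.edge j) x := by
  have h : ContDiffOn ℝ 1 (N.pd u j) (N.edge j) :=
    (hu.2 j).derivWithin (uniqueDiffOn_Icc (N.l_pos j)) (by norm_num)
  exact (h.differentiableOn (by norm_num) x hx).hasDerivWithinAt

lemma param_mem_edge (i : N.I) (j : N.J) : N.param i j ∈ N.edge j := by
  have := N.l_pos j
  unfold param edge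
  split_ifs
  · exact ⟨le_rfl, this.le⟩
  · exact ⟨this.le, le_rfl⟩

lemma exists_inc_param_eq (j : N.J) (hx : x = 0 ∨ x = N.l j) :
    ∃ i, j ∈ N.Inc i ∧ N.param i j = x := by
  rcases hx with rfl | rfl
  · exact ⟨N.s j, Or.inl rfl, by simp [param]⟩
  · exact ⟨N.t j, Or.inr rfl, by simp [param, N.st_ne j]⟩

/-- If `w₂ - w₁` attains its maximum at a vertex and the Kirchhoff sums there are ordered, then
all the derivatives of `w₂ - w₁` vanish at that vertex. -/
lemma pd_sub_eq_zero_of_isMax {β : N.I → N.J → ℝ} {i : N.I} {w₁ w₂ : N.J → ℝ → ℝ}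
    (hβ : ∀ j ∈ N.Inc i, 0 < β i j) (hw₁ : N.IsC2 w₁) (hw₂ : N.IsC2 w₂)
    (hk : N.kir β w₁ i ≤ N.kir β w₂ i)
    (hmax : ∀ j ∈ N.Inc i, IsMaxOn (fun x => w₂ j x - w₁ j x) (N.edge j) (N.param i j)) :
    ∀ j ∈ N.Inc i, N.pd w₂ j (N.param i j) - N.pd w₁ j (N.param i j) = 0 := by
  classical
  have hsgn : ∀ j ∈ N.Inc i,
      N.sgn i j * (N.pd w₂ j (N.param i j) - N.pd w₁ j (N.param i j)) ≤ 0 := by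
    intro j hj
    have hl := N.l_pos j
    have hp := param_mem_edge i j
    have h := fun y (hy : y ∈ N.edge j) => (hmax j hj).hasDerivWithinAt_mul_sub_nonpos
      (convex_Icc _ _) ((hw₂.hasDerivWithinAt hp).sub (hw₁.hasDerivWithinAt hp)) hp hy
    have h0 := h 0 ⟨le_rfl, hl.le⟩
    have h1 := h (N.l j) ⟨hl.le, le_rfl⟩
    unfold sgn param at *
    split_ifs at * <;> nlinarith
  have hterm : ∀ j ∈ Finset.univ, (if j ∈ N.Inc i then
      β i j * (N.sgn i j * (N.pd w₂ j (N.param i j) - N.pd w₁ j (N.param i j))) else 0) ≤ 0 := by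
    intro j _
    split_ifs with hj
    · exact mul_nonpos_of_nonneg_of_nonpos (hβ j hj).le (hsgn j hj)
    · exact le_rfl
  have hsum : (∑ j : N.J, if j ∈ N.Inc i then
      β i j * (N.sgn i j * (N.pd w₂ j (N.param i j) - N.pd w₁ j (N.param i j))) else 0) =
      N.kir β w₂ i - N.kir β w₁ i := by
    unfold kir incSum
    rw [← Finset.sum_sub_distrib]
    refine Finset.sum_congr rfl fun j _ => ?_
    split_ifs <;> ring
  have hzero := (Finset.sum_eq_zero_iff_of_nonpos hterm).1
    (le_antisymm (Finset.sum_nonpos hterm) (by rw [hsum]; linarith))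
  intro j hj
  have h := hzero j (Finset.mem_univ j)
  rw [if_pos hj] at h
  have hs : N.sgn i j ≠ 0 := by unfold sgn; split_ifs <;> norm_num
  exact ((mul_eq_zero.1 ((mul_eq_zero.1 h).resolve_left (hβ j hj).ne')).resolve_left hs)

end Network

open Network in
/-- **Proposition 3.7** (comparison principle under a Lipschitz growth condition). -/
theorem comparison_viscous_lipschitz
    (N : Network) (H : N.J → ℝ → ℝ → ℝ → ℝ)
    (hH0 : N.H0 H) (hH1 : N.H1 H)
    (hLip : ∃ K > 0, ∀ j, ∀ x ∈ N.edge j, ∀ r s p q : ℝ,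
      |H j x r p - H j x s q| ≤ K * (|r - s| + |p - q|))
    (β : N.I → N.J → ℝ)
    (hβ : ∀ i ∈ N.IT, ∀ j ∈ N.Inc i, 0 < β i j)
    (ε : ℝ) (hε : 0 < ε)
    (w₁ w₂ : N.J → ℝ → ℝ) (hw₁ : N.IsC2 w₁) (hw₂ : N.IsC2 w₂)
    (hCP : N.CP H β ε w₁ w₂) :
    ∀ j, ∀ x ∈ N.edge j, w₂ j x ≤ w₁ j x := by
  obtain ⟨K, hK, hLip⟩ := hLip
  obtain ⟨hpde, hkir, hbd⟩ := hCP
  have hdu : ∀ j, ∀ x ∈ N.edge j, HasDerivWithinAt (fun x => w₂ j x - w₁ j x)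
      (N.pd w₂ j x - N.pd w₁ j x) (N.edge j) x :=
    fun j x hx => (hw₂.hasDerivWithinAt hx).sub (hw₁.hasDerivWithinAt hx)
  have hddu : ∀ j, ∀ x ∈ N.edge j, HasDerivWithinAt (fun x => N.pd w₂ j x - N.pd w₁ j x)
      (N.pd2 w₂ j x - N.pd2 w₁ j x) (N.edge j) x :=
    fun j x hx => (hw₂.hasDerivWithinAt_pd hx).sub (hw₁.hasDerivWithinAt_pd hx)
  have hineq : ∀ j, ∀ x ∈ N.edge j, 0 < w₂ j x - w₁ j x →
      -(K / ε) * |N.pd w₂ j x - N.pd w₁ j x| ≤ N.pd2 w₂ j x - N.pd2 w₁ j x := by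
    intro j x hx hpos
    have h₁ := hpde j x hx
    have h₂ := hH1 j x hx (N.pd w₂ j x) (sub_pos.1 hpos).le
    have h₃ := neg_le_of_abs_le
      (hLip j x hx (w₁ j x) (w₁ j x) (N.pd w₂ j x) (N.pd w₁ j x))
    simp only [sub_self, abs_zero, zero_add] at h₂ h₃
    rw [← mul_le_mul_iff_right₀ hε]
    have h₄ : ε * (-(K / ε) * |N.pd w₂ j x - N.pd w₁ j x|) =
        -(K * |N.pd w₂ j x - N.pd w₁ j x|) := by
      field_simp
    rw [h₄]
    linarith
  have hloc : ∀ j, ∃ x ∈ N.edge j, IsMaxOn (fun x => w₂ j x - w₁ j x) (N.edge j) x :=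
    fun j => isCompact_Icc.exists_isMaxOn (nonempty_Icc.2 (N.l_pos j).le)
      fun x hx => (hdu j x hx).continuousWithinAt
  choose X hX hXmax using hloc
  obtain ⟨j₀, hj₀⟩ := Finite.exists_max fun j => w₂ j (X j) - w₁ j (X j)
  obtain ⟨M, hMdef⟩ : ∃ M, w₂ j₀ (X j₀) - w₁ j₀ (X j₀) = M := ⟨_, rfl⟩
  have hle : ∀ j, ∀ x ∈ N.edge j, w₂ j x - w₁ j x ≤ M :=
    fun j x hx => (hXmax j hx).trans (hMdef ▸ hj₀ j)
  suffices hM : M ≤ 0 from fun j x hx => by linarith [hle j x hx]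
  by_contra! hM
  have hconst : ∀ j, ∀ y ∈ N.edge j, w₂ j y - w₁ j y = M →
      N.pd w₂ j y - N.pd w₁ j y = 0 → ∀ x ∈ N.edge j, w₂ j x - w₁ j x = M :=
    fun j y hy hyM hy0 => eq_max_of_deriv2_ge (hdu j) (hddu j) (hineq j) hM (hle j) hy hyM hy0
  have hcompat : ∀ i, ∀ j ∈ N.Inc i, w₂ j (N.param i j) - w₁ j (N.param i j) = M →
      ∀ k ∈ N.Inc i, w₂ k (N.param i k) - w₁ k (N.param i k) = M := by
    intro i j hj h k hk
    rw [← h, hw₁.1 i k hk j hj, hw₂.1 i k hk j hj]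
  have hstart : ∃ i, ∃ j ∈ N.Inc i, w₂ j (N.param i j) - w₁ j (N.param i j) = M := by
    have hx := hX j₀
    by_cases hend : X j₀ = 0 ∨ X j₀ = N.l j₀
    · obtain ⟨i, hi, hp⟩ := exists_inc_param_eq j₀ hend
      exact ⟨i, j₀, hi, by rw [hp, hMdef]⟩
    · push Not at hend
      have h := fun y (hy : y ∈ N.edge j₀) => (hXmax j₀).hasDerivWithinAt_mul_sub_nonpos
        (convex_Icc _ _) (hdu j₀ _ hx) hx hy
      have hl := N.l_pos j₀
      have h0 := h 0 ⟨le_rfl, hl.le⟩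
      have h1 := h (N.l j₀) ⟨hl.le, le_rfl⟩
      have hx0 : 0 < X j₀ := lt_of_le_of_ne hx.1 hend.1.symm
      have hx1 : X j₀ < N.l j₀ := lt_of_le_of_ne hx.2 hend.2
      refine ⟨N.s j₀, j₀, Or.inl rfl, hconst j₀ _ hx hMdef ?_ _ (param_mem_edge _ _)⟩
      apply le_antisymm <;> nlinarith
  obtain ⟨i₀, hi₀⟩ := hstart
  have hnotIB : ∀ i, (∃ j ∈ N.Inc i, w₂ j (N.param i j) - w₁ j (N.param i j) = M) →
      i ∈ N.IT := by
    rintro i ⟨j, hj, h⟩ hi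
    linarith [hbd i hi j hj]
  have hreach : ∀ i, ∃ j ∈ N.Inc i, w₂ j (N.param i j) - w₁ j (N.param i j) = M := by
    intro i
    induction N.conn i₀ i with
    | refl => exact hi₀
    | @tail a b _ hab ih =>
      obtain ⟨k, hk⟩ := hab
      have hka : k ∈ N.Inc a := hk.imp And.left And.right
      have hkb : k ∈ N.Inc b := hk.symm.imp And.left And.right
      have haT := hnotIB a ih
      obtain ⟨j, hj, h⟩ := ih
      have hall := hcompat a j hj h
      have hzero := pd_sub_eq_zero_of_isMax (hβ a haT) hw₁ hw₂ (hkir a haT)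
        fun m hm y hy => (hle m y hy).trans (hall m hm).ge
      exact ⟨k, hkb, hconst k _ (param_mem_edge a k) (hall k hka) (hzero k hka) _
        (param_mem_edge b k)⟩
  obtain ⟨b, hb⟩ := N.IB_ne
  exact hnotIB b (hreach b) hb
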